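/- arXiv:2411.00713 — 10 statements merged into one kernel-verified Lean document; each statement's English description precedes it below -/
import Mathlib

section
/- Let E be a convex expectation on H. Then E[X + c·1] = E[X] + c for all X ∈ H and c ∈ ℝ (cash invariance). -/
/-- A functional that is convex along `H` and fixes constants is cash subadditive. -/
theorem apply_add_const_le_of_convex {Ω : Type*} (H : Submodule ℝ (Ω → ℝ))
    (hconst : ∀ c : ℝ, (fun _ : Ω => c) ∈ H)
    (E : (Ω → ℝ) → ℝ)
    (hEconst : ∀ c : ℝ, E (fun _ => c) = c)
    (hEconv : ∀ X Y : Ω → ℝ, X ∈ H → Y ∈ H → ∀ l : ℝ, l ∈ Set.Icc (0 : ℝ) 1 →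
      E (fun ω => l * X ω + (1 - l) * Y ω) ≤ l * E X + (1 - l) * E Y)
    {X : Ω → ℝ} (hX : X ∈ H) (c : ℝ) : E (fun ω => X ω + c) ≤ E X + c := by
  have hmul (a : ℝ) : (fun ω => a * X ω) ∈ H := H.smul_mem a hX
  have key (ε : ℝ) (h0 : 0 < ε) (h1 : ε ≤ 1) :
      (1 + ε) * E (fun ω => X ω + c) ≤
        (1 - ε) * E X + ε * E (fun ω => 2 * X ω) + (1 + ε) * c := by
    have h2 := hEconv _ X (hmul 2) hX ε ⟨h0.le, h1⟩
    have h3 := hEconv _ _ (hmul (1 + ε)) (hconst (c * (1 + ε) / ε)) (1 / (1 + ε))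
      ⟨by positivity, by rw [div_le_one (by positivity)]; linarith⟩
    have e2 : (fun ω => ε * (2 * X ω) + (1 - ε) * X ω) = fun ω => (1 + ε) * X ω := by
      funext ω; ring
    have e3 : (fun ω => 1 / (1 + ε) * ((1 + ε) * X ω) +
        (1 - 1 / (1 + ε)) * (c * (1 + ε) / ε)) = fun ω => X ω + c := by
      funext ω; field_simp; ring
    rw [e2] at h2
    rw [e3, hEconst] at h3
    have h4 := mul_le_mul_of_nonneg_left h3 (show 0 ≤ 1 + ε by positivity)
    have e4 : (1 + ε) * (1 / (1 + ε) * E (fun ω => (1 + ε) * X ω) +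
        (1 - 1 / (1 + ε)) * (c * (1 + ε) / ε)) =
        E (fun ω => (1 + ε) * X ω) + (1 + ε) * c := by
      field_simp; ring
    linarith
  by_contra! hlt
  set D := E (fun ω => X ω + c) - E X - c with hD
  set K := E (fun ω => X ω + c) + E X - E (fun ω => 2 * X ω) - c with hK
  have hD0 : 0 < D := by linarith
  have hpos : 0 < D + |K| := by positivity
  have h := key (D / (D + |K|)) (by positivity)
    (by rw [div_le_one hpos]; linarith [abs_nonneg K])
  have h' : D + D / (D + |K|) * K ≤ 0 := by rw [hD, hK] at *; linarith
  have h2 : D / (D + |K|) * (-|K|) ≤ D / (D + |K|) * K :=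
    mul_le_mul_of_nonneg_left (neg_abs_le K) (by positivity)
  have h3 : D + D / (D + |K|) * (-|K|) = D ^ 2 / (D + |K|) := by field_simp; ring
  have h4 : 0 < D ^ 2 / (D + |K|) := by positivity
  linarith


/-- A convex expectation `E` on `H` is cash invariant:
`E[X + c·1] = E[X] + c` for all `X ∈ H` and `c ∈ ℝ`. -/
theorem stmt_1 {Ω : Type*} (H : Submodule ℝ (Ω → ℝ))
    (hconst : ∀ c : ℝ, (fun _ : Ω => c) ∈ H)
    (habs : ∀ X ∈ H, (fun ω => |X ω|) ∈ H)
    (E : (Ω → ℝ) → ℝ)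
    (hEconst : ∀ c : ℝ, E (fun _ => c) = c)
    (hEmono : ∀ X Y : Ω → ℝ, X ∈ H → Y ∈ H → (∀ ω, X ω ≤ Y ω) → E X ≤ E Y)
    (hEconv : ∀ X Y : Ω → ℝ, X ∈ H → Y ∈ H → ∀ l : ℝ, l ∈ Set.Icc (0 : ℝ) 1 →
      E (fun ω => l * X ω + (1 - l) * Y ω) ≤ l * E X + (1 - l) * E Y) :
    ∀ X ∈ H, ∀ c : ℝ, E (fun ω => X ω + c) = E X + c := by
  intro X hX c
  have hXc : (fun ω => X ω + c) ∈ H := H.add_mem hX (hconst c)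
  have h1 := apply_add_const_le_of_convex H hconst E hEconst hEconv hX c
  have h2 := apply_add_const_le_of_convex H hconst E hEconst hEconv hXc (-c)
  simp only [add_neg_cancel_right] at h2
  exact le_antisymm h1 (by linarith)
end

section
/- Let E be a convex expectation on H. Then |E[X] − E[Y]| ≤ ‖X − Y‖_∞ for all bounded X, Y ∈ H, where ‖X − Y‖_∞ := sup_{ω ∈ Ω} |X(ω) − Y(ω)|. -/
/-- If `X ≤ Y + d` with `Y` bounded above, then `E[X] ≤ E[Y] + d` for a convex expectation `E`. -/
theorem convexExpectation_le_add_const {Ω : Type*} (H : Submodule ℝ (Ω → ℝ))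
    (hconst : ∀ c : ℝ, (fun _ : Ω => c) ∈ H)
    (E : (Ω → ℝ) → ℝ)
    (hEconst : ∀ c : ℝ, E (fun _ => c) = c)
    (hEmono : ∀ X Y : Ω → ℝ, X ∈ H → Y ∈ H → (∀ ω, X ω ≤ Y ω) → E X ≤ E Y)
    (hEconv : ∀ X Y : Ω → ℝ, X ∈ H → Y ∈ H → ∀ l : ℝ, l ∈ Set.Icc (0 : ℝ) 1 →
      E (fun ω => l * X ω + (1 - l) * Y ω) ≤ l * E X + (1 - l) * E Y)
    {X Y : Ω → ℝ} (hX : X ∈ H) (hY : Y ∈ H) {M d : ℝ} (hM : ∀ ω, Y ω ≤ M)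
    (hd : ∀ ω, X ω ≤ Y ω + d) : E X ≤ E Y + d := by
  have hEM : E Y ≤ M := hEconst M ▸ hEmono Y _ hY (hconst M) hM
  have key : ∀ t : ℝ, 0 < t → t ≤ 1 → E X ≤ E Y + d + t * (M - E Y) := by
    intro t ht ht1
    have hmem : (fun ω => (1 - t) * Y ω + (1 - (1 - t)) * (M + d / t)) ∈ H :=
      H.add_mem (H.smul_mem (1 - t) hY) (hconst _)
    have hle := hEmono X _ hX hmem fun ω => by
      have h1 := mul_nonneg ht.le (sub_nonneg.2 (hM ω))
      have h2 : t * (d / t) = d := mul_div_cancel₀ d ht.ne'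
      linarith [hd ω]
    have hconv := hEconv Y _ hY (hconst (M + d / t)) (1 - t) ⟨by linarith, by linarith⟩
    rw [hEconst] at hconv
    have h2 : t * (d / t) = d := mul_div_cancel₀ d ht.ne'
    linarith
  by_contra! hlt
  set e := E X - (E Y + d) with he
  have hepos : 0 < e := sub_pos.2 hlt
  have hden : 0 < e + (M - E Y) + 1 := by linarith
  have h := key (e / (e + (M - E Y) + 1)) (div_pos hepos hden)
    ((div_le_one hden).2 (by linarith))
  have hquot : e ≤ e * (M - E Y) / (e + (M - E Y) + 1) := by
    rw [mul_div_right_comm]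
    linarith
  rw [le_div_iff₀ hden] at hquot
  nlinarith

/-- A convex expectation `E` on `H` satisfies
`|E[X] − E[Y]| ≤ ‖X − Y‖_∞` for all bounded `X, Y ∈ H`, where
`‖X − Y‖_∞ = ⨆ ω, |X ω − Y ω|`. -/
theorem stmt_2 {Ω : Type*} (H : Submodule ℝ (Ω → ℝ))
    (hconst : ∀ c : ℝ, (fun _ : Ω => c) ∈ H)
    (habs : ∀ X ∈ H, (fun ω => |X ω|) ∈ H)
    (E : (Ω → ℝ) → ℝ)
    (hEconst : ∀ c : ℝ, E (fun _ => c) = c)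
    (hEmono : ∀ X Y : Ω → ℝ, X ∈ H → Y ∈ H → (∀ ω, X ω ≤ Y ω) → E X ≤ E Y)
    (hEconv : ∀ X Y : Ω → ℝ, X ∈ H → Y ∈ H → ∀ l : ℝ, l ∈ Set.Icc (0 : ℝ) 1 →
      E (fun ω => l * X ω + (1 - l) * Y ω) ≤ l * E X + (1 - l) * E Y) :
    ∀ X ∈ H, ∀ Y ∈ H, (∃ M : ℝ, ∀ ω, |X ω| ≤ M) → (∃ M : ℝ, ∀ ω, |Y ω| ≤ M) →
      |E X - E Y| ≤ ⨆ ω, |X ω - Y ω| := by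
  rintro X hX Y hY ⟨M, hM⟩ ⟨N, hN⟩
  have hbdd : BddAbove (Set.range fun ω => |X ω - Y ω|) := by
    refine ⟨M + N, ?_⟩
    rintro _ ⟨ω, rfl⟩
    exact (norm_sub_le (X ω) (Y ω)).trans (add_le_add (hM ω) (hN ω))
  have hle : ∀ ω, |X ω - Y ω| ≤ ⨆ ω, |X ω - Y ω| := le_ciSup hbdd
  have hXY := convexExpectation_le_add_const H hconst E hEconst hEmono hEconv hX hY
    (fun ω => (abs_le.1 (hN ω)).2) (fun ω => by linarith [(abs_le.1 (hle ω)).2])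
  have hYX := convexExpectation_le_add_const H hconst E hEconst hEmono hEconv hY hX
    (fun ω => (abs_le.1 (hM ω)).2) (fun ω => by linarith [(abs_le.1 (hle ω)).1])
  exact abs_sub_le_iff.2 ⟨by linarith, by linarith⟩
end

section
/- Let E be a convex expectation on H and let X ∈ H satisfy E[aX] = 0 for every a ∈ ℝ. Then E[X + Y] = E[Y] for all Y ∈ H. -/
/-- Adding a position all of whose multiples have expectation zero does not increase
a convex functional. -/
theorem convexExpectation_add_le {Ω : Type*} (H : Submodule ℝ (Ω → ℝ)) (E : (Ω → ℝ) → ℝ)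
    (hEconv : ∀ X Y : Ω → ℝ, X ∈ H → Y ∈ H → ∀ l : ℝ, l ∈ Set.Icc (0 : ℝ) 1 →
      E (fun ω => l * X ω + (1 - l) * Y ω) ≤ l * E X + (1 - l) * E Y)
    (X : Ω → ℝ) (hX : X ∈ H) (hXzero : ∀ a : ℝ, E (fun ω => a * X ω) = 0)
    {Y : Ω → ℝ} (hY : Y ∈ H) : E (fun ω => X ω + Y ω) ≤ E Y := by
  have smul_mem (c : ℝ) {Z : Ω → ℝ} (hZ : Z ∈ H) : (fun ω => c * Z ω) ∈ H := H.smul_mem c hZ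
  have key (e : ℝ) (he : 0 < e) (he1 : e ≤ 1) :
      (1 + e) * E (fun ω => X ω + Y ω) ≤ (1 - e) * E Y + e * E (fun ω => 2 * Y ω) := by
    have h2 : E (fun ω => (1 + e) * Y ω) ≤ e * E (fun ω => 2 * Y ω) + (1 - e) * E Y := by
      convert hEconv _ Y (smul_mem 2 hY) hY e ⟨he.le, he1⟩ using 3
      ring
    have h1 : E (fun ω => X ω + Y ω) ≤ (1 + e)⁻¹ * E (fun ω => (1 + e) * Y ω) := by
      have h := hEconv _ _ (smul_mem (1 + e) hY) (smul_mem ((1 + e) / e) hX) (1 + e)⁻¹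
        ⟨by positivity, inv_le_one_of_one_le₀ (by linarith)⟩
      rw [hXzero, mul_zero, add_zero] at h
      convert h using 3
      field_simp
      ring
    have h3 := (le_inv_mul_iff₀ (by positivity : 0 < 1 + e)).1 h1
    linarith
  by_contra! hlt
  set A := E (fun ω => X ω + Y ω)
  set K := E (fun ω => 2 * Y ω) - E Y - A with hK
  have hd : 0 < A - E Y := sub_pos.2 hlt
  have hpos : 0 < A - E Y + |K| + 1 := by positivity
  have h := key ((A - E Y) / (A - E Y + |K| + 1)) (by positivity)
    ((div_le_one hpos).2 (by linarith [abs_nonneg K]))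
  have h' : A - E Y ≤ (A - E Y) / (A - E Y + |K| + 1) * K := by rw [hK] at *; linarith
  rw [div_mul_eq_mul_div, le_div_iff₀ hpos] at h'
  nlinarith [le_abs_self K]

/-- Let `E` be a convex expectation on `H` and `X ∈ H` with
`E[aX] = 0` for every `a ∈ ℝ`. Then `E[X + Y] = E[Y]` for all `Y ∈ H`. -/
theorem stmt_4 {Ω : Type*} (H : Submodule ℝ (Ω → ℝ))
    (hconst : ∀ c : ℝ, (fun _ : Ω => c) ∈ H)
    (habs : ∀ X ∈ H, (fun ω => |X ω|) ∈ H)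
    (E : (Ω → ℝ) → ℝ)
    (hEconst : ∀ c : ℝ, E (fun _ => c) = c)
    (hEmono : ∀ X Y : Ω → ℝ, X ∈ H → Y ∈ H → (∀ ω, X ω ≤ Y ω) → E X ≤ E Y)
    (hEconv : ∀ X Y : Ω → ℝ, X ∈ H → Y ∈ H → ∀ l : ℝ, l ∈ Set.Icc (0 : ℝ) 1 →
      E (fun ω => l * X ω + (1 - l) * Y ω) ≤ l * E X + (1 - l) * E Y)
    (X : Ω → ℝ) (hX : X ∈ H) (hXzero : ∀ a : ℝ, E (fun ω => a * X ω) = 0) :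
    ∀ Y ∈ H, E (fun ω => X ω + Y ω) = E Y := by
  have hle := fun X hX hX0 Y hY => convexExpectation_add_le H E hEconv X hX hX0 (Y := Y) hY
  intro Y hY
  refine le_antisymm (hle X hX hXzero Y hY) ?_
  have h := hle (-X) (H.neg_mem hX) (fun a => by simpa using hXzero (-a)) (X + Y)
    (H.add_mem hX hY)
  simpa [Pi.add_def] using h
end

section
/- Assume the family (p̂_s)_{s∈ℕ} satisfies conditions (p̂1) and (p̂2). Then condition (p̂3) [for all s ≤ t in ℕ and g, g̃ ∈ 𝒳: p̂_t g ≤ p̂_t g̃ pointwise implies p̂_s g ≤ p̂_s g̃ pointwise] holds if and only if condition (p̂3') [p̂_s(p̂_t g) = p̂_s g for all s ≤ t in ℕ and all g ∈ 𝒳] holds. -/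
/-- For the path-dependent pricing operators `p̂_s : 𝒳 → 𝒳_s`
satisfying (p̂1) and (p̂2), condition (p̂3) (time consistency of the order)
holds if and only if condition (p̂3') (`p̂_s(p̂_t g) = p̂_s g` for `s ≤ t`)
holds. -/
theorem stmt_9 {d : ℕ}
    (Xk : ℕ → Set ((ℕ → Fin d → ℝ) → ℝ))
    (hXk : ∀ k, Xk k = {g : (ℕ → Fin d → ℝ) → ℝ | Continuous g ∧
      (∃ M : ℝ, ∀ x, |g x| ≤ M) ∧
      ∀ x y : ℕ → Fin d → ℝ, (∀ i ≤ k, x i = y i) → g x = g y})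
    (X : Set ((ℕ → Fin d → ℝ) → ℝ)) (hX : X = ⋃ k, Xk k)
    (p : ℕ → ((ℕ → Fin d → ℝ) → ℝ) → ((ℕ → Fin d → ℝ) → ℝ))
    (hmap : ∀ s : ℕ, ∀ g ∈ X, p s g ∈ Xk s)
    (hp1a : ∀ s : ℕ, p s 0 = 0)
    (hp1b : ∀ s : ℕ, ∀ g ∈ X, ∀ g' ∈ Xk s, p s (g + g') = p s g + g')
    (hp2 : ∀ s : ℕ, ∀ g ∈ X, ∀ g' ∈ X, (∀ x, g x ≤ g' x) → ∀ x, p s g x ≤ p s g' x) :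
    (∀ s t : ℕ, s ≤ t → ∀ g ∈ X, ∀ g' ∈ X,
        (∀ x, p t g x ≤ p t g' x) → ∀ x, p s g x ≤ p s g' x)
      ↔ (∀ s t : ℕ, s ≤ t → ∀ g ∈ X, p s (p t g) = p s g) := by
  have zero_mem : (0 : (ℕ → Fin d → ℝ) → ℝ) ∈ X := by
    rw [hX, Set.mem_iUnion]
    refine ⟨0, ?_⟩
    rw [hXk]
    exact ⟨continuous_const, ⟨0, fun _ => by simp⟩, fun _ _ _ => rfl⟩
  have p_mem : ∀ t, ∀ g ∈ X, p t g ∈ X := fun t g hg => by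
    rw [hX]
    exact Set.mem_iUnion.2 ⟨t, hmap t g hg⟩
  have p_idem : ∀ t, ∀ g ∈ X, p t (p t g) = p t g := fun t g hg => by
    simpa [hp1a] using hp1b t 0 zero_mem (p t g) (hmap t g hg)
  constructor
  · intro h s t hst g hg
    funext x
    exact le_antisymm
      (h s t hst _ (p_mem t g hg) g hg (fun y => (congrFun (p_idem t g hg) y).le) x)
      (h s t hst g hg _ (p_mem t g hg) (fun y => (congrFun (p_idem t g hg) y).ge) x)
  · intro h s t hst g hg g' hg' hle
    rw [← h s t hst g hg, ← h s t hst g' hg']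
    exact hp2 s _ (p_mem t g hg) _ (p_mem t g' hg') hle
end

section
/- Assume the family (p̂_s)_{s∈ℕ} satisfies conditions (p̂1), (p̂2), and (p̂3') [p̂_s(p̂_t g) = p̂_s g for all s ≤ t in ℕ and all g ∈ 𝒳]. Suppose in addition there are operators p_t mapping bounded continuous functions ℝ^d → ℝ to bounded continuous functions ℝ^d → ℝ, for t ∈ ℕ, such that whenever s ≤ t ≤ u in ℕ, f : ℝ^d → ℝ is bounded continuous, and g ∈ 𝒳_u is given by g(x_0,…,x_u,…) = f(x_t), then (p̂_s g)(x_0,…,x_s,…) = (p_{t−s} f)(x_s) for all paths. Then p_s(p_t f) = p_{s+t} f for all s, t ∈ ℕ and all bounded continuous f : ℝ^d → ℝ. -/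
/-- Suppose the path-dependent pricing operators `p̂_s` satisfy
(p̂1), (p̂2), (p̂3'), and that there are operators `q_t` on bounded continuous
functions `ℝ^d → ℝ` such that for `s ≤ t ≤ u`, and `g ∈ 𝒳_u` given by
`g(x₀,…,x_u,…) = f(x_t)`, one has `(p̂_s g)(x) = (q_{t−s} f)(x_s)`. Then
`q_s(q_t f) = q_{s+t} f` for all `s, t ∈ ℕ` and bounded continuous `f`. -/
theorem stmt_10 {d : ℕ}
    (Xk : ℕ → Set ((ℕ → Fin d → ℝ) → ℝ))
    (hXk : ∀ k, Xk k = {g : (ℕ → Fin d → ℝ) → ℝ | Continuous g ∧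
      (∃ M : ℝ, ∀ x, |g x| ≤ M) ∧
      ∀ x y : ℕ → Fin d → ℝ, (∀ i ≤ k, x i = y i) → g x = g y})
    (X : Set ((ℕ → Fin d → ℝ) → ℝ)) (hX : X = ⋃ k, Xk k)
    (p : ℕ → ((ℕ → Fin d → ℝ) → ℝ) → ((ℕ → Fin d → ℝ) → ℝ))
    (hmap : ∀ s : ℕ, ∀ g ∈ X, p s g ∈ Xk s)
    (hp1a : ∀ s : ℕ, p s 0 = 0)
    (hp1b : ∀ s : ℕ, ∀ g ∈ X, ∀ g' ∈ Xk s, p s (g + g') = p s g + g')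
    (hp2 : ∀ s : ℕ, ∀ g ∈ X, ∀ g' ∈ X, (∀ x, g x ≤ g' x) → ∀ x, p s g x ≤ p s g' x)
    (hp3' : ∀ s t : ℕ, s ≤ t → ∀ g ∈ X, p s (p t g) = p s g)
    (q : ℕ → ((Fin d → ℝ) → ℝ) → ((Fin d → ℝ) → ℝ))
    (hq : ∀ (t : ℕ) (f : (Fin d → ℝ) → ℝ), Continuous f → (∃ M : ℝ, ∀ x, |f x| ≤ M) →
      Continuous (q t f) ∧ ∃ M : ℝ, ∀ x, |q t f x| ≤ M)
    (hcompat : ∀ s t u : ℕ, s ≤ t → t ≤ u → ∀ f : (Fin d → ℝ) → ℝ,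
      Continuous f → (∃ M : ℝ, ∀ x, |f x| ≤ M) →
      p s (fun x : ℕ → Fin d → ℝ => f (x t)) = fun x : ℕ → Fin d → ℝ => q (t - s) f (x s)) :
    ∀ s t : ℕ, ∀ f : (Fin d → ℝ) → ℝ, Continuous f → (∃ M : ℝ, ∀ x, |f x| ≤ M) →
      ∀ x : Fin d → ℝ, q s (q t f) x = q (s + t) f x := by
  intro s t f hf hfb x
  have hg : (fun y : ℕ → Fin d → ℝ => f (y (s + t))) ∈ X := by
    rw [hX, Set.mem_iUnion]
    refine ⟨s + t, ?_⟩
    rw [hXk]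
    refine ⟨by fun_prop, ?_, fun y z h => congrArg f (h _ le_rfl)⟩
    obtain ⟨M, hM⟩ := hfb
    exact ⟨M, fun y => hM _⟩
  obtain ⟨hqc, hqb⟩ := hq t f hf hfb
  have tower := hp3' 0 s (Nat.zero_le s) _ hg
  rw [hcompat s (s + t) (s + t) (Nat.le_add_right s t) le_rfl f hf hfb,
    hcompat 0 (s + t) (s + t) (Nat.zero_le _) le_rfl f hf hfb,
    Nat.add_sub_cancel_left, hcompat 0 s s (Nat.zero_le s) le_rfl _ hqc hqb] at tower
  exact congrFun tower (fun _ => x)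
end

section
/- Let (Ω,𝔄) be a measurable space, ζ : Ω → ℝ^d a bounded measurable map, and 𝒬 a nonempty set of probability measures on (Ω,𝔄). Assume that ∫_Ω (θᵀζ)^{2k−1} dQ = 0 for every Q ∈ 𝒬, θ ∈ ℝ^d and k ≥ 1, and that there exists δ > 0 with sup_{Q∈𝒬} ∫_Ω (θᵀζ)² dQ ≥ δ|θ|² for all θ ∈ ℝ^d. Then conditions (mgf1) and (mgf2) are satisfied for E[·] := sup_{Q∈𝒬} ∫_Ω · dQ. -/
open MeasureTheory Matrix

/-- The tangent line of `cosh` at `a` lies below its graph. -/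
theorem cosh_add_sinh_mul_sub_le_cosh (a x : ℝ) :
    Real.cosh a + Real.sinh a * (x - a) ≤ Real.cosh x := by
  have h1 := mul_le_mul_of_nonneg_left (Real.add_one_le_exp (x - a)) (Real.exp_pos a).le
  have h2 := mul_le_mul_of_nonneg_left (Real.add_one_le_exp (a - x)) (Real.exp_pos (-a)).le
  rw [← Real.exp_add, show a + (x - a) = x by ring] at h1
  rw [← Real.exp_add, show -a + (a - x) = -x by ring] at h2
  rw [Real.cosh_eq, Real.cosh_eq, Real.sinh_eq]
  linarith

theorem one_add_sq_div_two_le_cosh {s : ℝ} (hs : 0 ≤ s) : 1 + s ^ 2 / 2 ≤ Real.cosh s := by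
  have h := Real.self_le_sinh_iff.2 (show 0 ≤ s / 2 by positivity)
  have h2 := Real.cosh_two_mul (s / 2)
  rw [Real.cosh_sq, show 2 * (s / 2) = s by ring] at h2
  nlinarith

theorem sq_div_four_le_log_cosh {s : ℝ} (hs : 0 ≤ s) (hs1 : s ≤ 1) :
    s ^ 2 / 4 ≤ Real.log (Real.cosh s) := by
  rw [Real.le_log_iff_exp_le (Real.cosh_pos s)]
  refine le_trans ?_ (one_add_sq_div_two_le_cosh hs)
  have h1 : s ^ 2 ≤ 1 := by nlinarith
  have h2 := Real.one_sub_le_exp_neg (s ^ 2 / 4)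
  have h3 : Real.exp (s ^ 2 / 4) * Real.exp (-(s ^ 2 / 4)) = 1 := by
    rw [← Real.exp_add]; simp
  have h4 : (1 + s ^ 2 / 2) * (1 - s ^ 2 / 4) ≥ 1 := by nlinarith [sq_nonneg s]
  have h5 := Real.exp_pos (s ^ 2 / 4)
  have h6 : Real.exp (s ^ 2 / 4) * (1 - s ^ 2 / 4) ≤ 1 := by
    exact (mul_le_mul_of_nonneg_left h2 h5.le).trans_eq h3
  have h7 : 0 < 1 - s ^ 2 / 4 := by linarith
  exact le_of_mul_le_mul_right (h6.trans h4) h7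

theorem div_four_le_log_cosh {s : ℝ} (hs : 1 ≤ s) : s / 4 ≤ Real.log (Real.cosh s) := by
  rw [Real.le_log_iff_exp_le (Real.cosh_pos s)]
  have h1 := Real.quadratic_le_exp_of_nonneg (show 0 ≤ 3 * s / 4 by linarith)
  have h2 : Real.exp s = Real.exp (s / 4) * Real.exp (3 * s / 4) := by
    rw [← Real.exp_add]; ring_nf
  have h3 : 2 ≤ Real.exp (3 * s / 4) := by nlinarith
  have h4 := mul_le_mul_of_nonneg_left h3 (Real.exp_pos (s / 4)).le
  rw [Real.cosh_eq]
  linarith [Real.exp_pos (-s)]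

/-- A bounded random variable whose odd moments vanish has a vanishing integral of `sinh`. -/
theorem integral_sinh_eq_zero_of_odd_moments {Ω : Type*} [MeasurableSpace Ω] (Q : Measure Ω)
    [IsProbabilityMeasure Q] {X : Ω → ℝ} (hX : Measurable X) {B : ℝ} (hB : ∀ ω, |X ω| ≤ B)
    (hodd : ∀ n : ℕ, ∫ ω, X ω ^ (2 * n + 1) ∂Q = 0) : ∫ ω, Real.sinh (X ω) ∂Q = 0 := by
  have key : HasSum (fun n : ℕ => ∫ ω, X ω ^ (2 * n + 1) / ((2 * n + 1).factorial : ℝ) ∂Q)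
      (∫ ω, Real.sinh (X ω) ∂Q) := by
    refine hasSum_integral_of_dominated_convergence
      (fun n _ => B ^ (2 * n + 1) / ((2 * n + 1).factorial : ℝ)) ?_ ?_ ?_ ?_ ?_
    · exact fun n => ((hX.pow_const _).div_const _).aestronglyMeasurable
    · refine fun n => Filter.Eventually.of_forall fun ω => ?_
      rw [Real.norm_eq_abs, abs_div, abs_pow, Nat.abs_cast]
      have := hB ω
      gcongr
    · exact Filter.Eventually.of_forall fun _ => (Real.hasSum_sinh B).summable
    · exact integrable_const _
    · exact Filter.Eventually.of_forall fun ω => Real.hasSum_sinh (X ω)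
  simp only [integral_div, hodd, zero_div] at key
  exact key.unique hasSum_zero

theorem integrable_of_abs_le {Ω : Type*} [MeasurableSpace Ω] {Q : Measure Ω} [IsFiniteMeasure Q]
    {f : Ω → ℝ} (hf : Measurable f) {B : ℝ} (hB : ∀ ω, |f ω| ≤ B) : Integrable f Q :=
  Integrable.of_bound hf.aestronglyMeasurable B (Filter.Eventually.of_forall hB)

theorem integral_le_of_forall_le {Ω : Type*} [MeasurableSpace Ω] {Q : Measure Ω}
    [IsProbabilityMeasure Q] {f : Ω → ℝ} {B : ℝ} (h0 : ∀ ω, 0 ≤ f ω) (hB : ∀ ω, f ω ≤ B) :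
    ∫ ω, f ω ∂Q ≤ B := by
  have := integral_mono_of_nonneg (μ := Q) (Filter.Eventually.of_forall h0)
    (integrable_const B) (Filter.Eventually.of_forall hB)
  simpa using this

theorem le_biSup_of_mem_of_le {α : Type*} {s : Set α} {f : α → ℝ} {B : ℝ} (hB0 : 0 ≤ B)
    (hB : ∀ a ∈ s, f a ≤ B) {a : α} (ha : a ∈ s) : f a ≤ ⨆ b ∈ s, f b := by
  have hbdd : BddAbove (Set.range fun b => ⨆ _ : b ∈ s, f b) := by
    refine ⟨B, ?_⟩
    rintro _ ⟨b, rfl⟩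
    exact Real.iSup_le (hB b) hB0
  refine le_trans ?_ (le_ciSup hbdd a)
  simp [ha]

/-- If `X` is bounded with vanishing odd moments, then `E[exp X]` is at least `cosh s`
for all `0 ≤ s ≤ E[|X|]`. -/
theorem cosh_le_integral_exp {Ω : Type*} [MeasurableSpace Ω] (Q : Measure Ω)
    [IsProbabilityMeasure Q] {X : Ω → ℝ} (hX : Measurable X) {B s : ℝ} (hB : ∀ ω, |X ω| ≤ B)
    (hodd : ∀ n : ℕ, ∫ ω, X ω ^ (2 * n + 1) ∂Q = 0) (hs : 0 ≤ s)
    (hsX : s ≤ ∫ ω, |X ω| ∂Q) : Real.cosh s ≤ ∫ ω, Real.exp (X ω) ∂Q := by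
  have hiX : Integrable (fun ω => |X ω|) Q :=
    integrable_of_abs_le (by fun_prop) (B := B) (by simpa using hB)
  have hiexp : Integrable (fun ω => Real.exp (X ω)) Q := by
    refine integrable_of_abs_le (by fun_prop) (B := Real.exp B) fun ω => ?_
    rw [Real.abs_exp]
    exact Real.exp_le_exp.2 ((le_abs_self _).trans (hB ω))
  have hiexp' : Integrable (fun ω => Real.exp (-X ω)) Q := by
    refine integrable_of_abs_le (by fun_prop) (B := Real.exp B) fun ω => ?_
    rw [Real.abs_exp]
    exact Real.exp_le_exp.2 ((neg_le_abs _).trans (hB ω))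
  have hicosh : Integrable (fun ω => Real.cosh (X ω)) Q := by
    simp only [Real.cosh_eq]
    exact (hiexp.add hiexp').div_const 2
  have hisinh : Integrable (fun ω => Real.sinh (X ω)) Q := by
    simp only [Real.sinh_eq]
    exact (hiexp.sub hiexp').div_const 2
  have hexp : ∫ ω, Real.exp (X ω) ∂Q = ∫ ω, Real.cosh (X ω) ∂Q := by
    simp only [← Real.cosh_add_sinh]
    rw [integral_add hicosh hisinh, integral_sinh_eq_zero_of_odd_moments Q hX hB hodd, add_zero]
  rw [hexp]
  have hilin : Integrable (fun ω => Real.sinh s * (|X ω| - s)) Q :=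
    (hiX.sub (integrable_const s)).const_mul _
  have hmono : ∫ ω, (Real.cosh s + Real.sinh s * (|X ω| - s)) ∂Q ≤ ∫ ω, Real.cosh (X ω) ∂Q := by
    refine integral_mono ((integrable_const _).add hilin) hicosh fun ω => ?_
    have := cosh_add_sinh_mul_sub_le_cosh s |X ω|
    rwa [Real.cosh_abs] at this
  rw [integral_add (integrable_const _) hilin,
    integral_const_mul, integral_sub hiX (integrable_const _)] at hmono
  simp only [integral_const, probReal_univ, one_smul] at hmono
  have := mul_nonneg (Real.sinh_nonneg_iff.2 hs) (sub_nonneg.2 hsX)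
  linarith

theorem abs_dotProduct_le_sqrt_mul {d : ℕ} (θ z : Fin d → ℝ) {K : ℝ} (hK : 0 ≤ K)
    (hz : z ⬝ᵥ z ≤ K ^ 2) : |θ ⬝ᵥ z| ≤ Real.sqrt (θ ⬝ᵥ θ) * K := by
  have h0 : 0 ≤ θ ⬝ᵥ θ := Finset.sum_nonneg fun i _ => mul_self_nonneg _
  refine abs_le_of_sq_le_sq ?_ (by positivity)
  rw [mul_pow, Real.sq_sqrt h0]
  have h := Finset.sum_mul_sq_le_sq_mul_sq Finset.univ θ z
  simp only [sq (θ _), sq (z _)] at h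
  exact h.trans (mul_le_mul_of_nonneg_left hz h0)

theorem mul_mul_le_log_cosh {b D r t : ℝ} (hb : 0 < b) (hD : 0 < D) (ht : 0 ≤ t)
    (htb : Real.sqrt t ≤ b / (4 * D)) (hr : 4 * D / b ^ 2 ≤ r) :
    D * r * t ≤ Real.log (Real.cosh (b * Real.sqrt t * r)) := by
  have hr0 : 0 ≤ r := le_trans (by positivity) hr
  have hu := Real.sqrt_nonneg t
  have hsq := Real.sq_sqrt ht
  set u := Real.sqrt t
  rw [le_div_iff₀ (by positivity)] at htb
  rw [div_le_iff₀ (by positivity)] at hr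
  rw [← hsq]
  rcases le_total (b * u * r) 1 with h | h
  · refine le_trans ?_ (sq_div_four_le_log_cosh (by positivity) h)
    have := mul_le_mul_of_nonneg_right hr (show 0 ≤ r * u ^ 2 by positivity)
    nlinarith
  · refine le_trans ?_ (div_four_le_log_cosh h)
    have := mul_le_mul_of_nonneg_right htb (show 0 ≤ r * u by positivity)
    nlinarith

/-- Let `ζ : Ω → ℝ^d` be bounded measurable and `𝒬` a nonempty
set of probability measures. Assume all odd mixed moments
`∫ (θᵀζ)^{2k−1} dQ` vanish and that `sup_{Q∈𝒬} ∫ (θᵀζ)² dQ ≥ δ|θ|²` for some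
`δ > 0`. Then conditions (mgf1) and (mgf2) hold for
`E[·] = sup_{Q∈𝒬} ∫ · dQ`. -/
theorem stmt_11 {Ω : Type*} [MeasurableSpace Ω] {d : ℕ}
    (ζ : Ω → Fin d → ℝ) (hζm : Measurable ζ) (hζb : ∃ M : ℝ, ∀ ω, ζ ω ⬝ᵥ ζ ω ≤ M)
    (𝒬 : Set (Measure Ω)) (h𝒬 : 𝒬.Nonempty)
    (hprob : ∀ Q ∈ 𝒬, IsProbabilityMeasure Q)
    (hodd : ∀ Q ∈ 𝒬, ∀ θ : Fin d → ℝ, ∀ k : ℕ, 1 ≤ k →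
      ∫ ω, (θ ⬝ᵥ ζ ω) ^ (2 * k - 1) ∂Q = 0)
    (hδ : ∃ δ > (0 : ℝ), ∀ θ : Fin d → ℝ,
      δ * (θ ⬝ᵥ θ) ≤ ⨆ Q ∈ 𝒬, ∫ ω, (θ ⬝ᵥ ζ ω) ^ 2 ∂Q) :
    (∃ M ≥ (0 : ℝ), ∃ t₁ > (0 : ℝ), ∀ t ∈ Set.Icc (0 : ℝ) t₁,
        Real.log (⨆ Q ∈ 𝒬, ∫ ω, Real.exp (t * (ζ ω ⬝ᵥ ζ ω)) ∂Q) ≤ M * t) ∧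
      (∀ C ≥ (0 : ℝ), ∃ t₂ > (0 : ℝ), ∃ R ≥ (0 : ℝ),
        ∀ t ∈ Set.Icc (0 : ℝ) t₂, ∀ θ : Fin d → ℝ, R ≤ Real.sqrt (θ ⬝ᵥ θ) →
          C * Real.sqrt (θ ⬝ᵥ θ) * t ≤
            Real.log (⨆ Q ∈ 𝒬,
              ∫ ω, Real.exp (Real.sqrt t * (θ ⬝ᵥ ζ ω) - t * (ζ ω ⬝ᵥ ζ ω)) ∂Q)) := by
  obtain ⟨M, hM⟩ := hζb
  obtain ⟨δ, hδ0, hδ⟩ := hδ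
  obtain ⟨K, hK1, hK⟩ : ∃ K : ℝ, 1 ≤ K ∧ ∀ ω, ζ ω ⬝ᵥ ζ ω ≤ K :=
    ⟨max M 1, le_max_right _ _, fun ω => (hM ω).trans (le_max_left _ _)⟩
  have hK0 : 0 < K := by linarith
  have hz0 : ∀ ω, 0 ≤ ζ ω ⬝ᵥ ζ ω := fun ω => Finset.sum_nonneg fun i _ => mul_self_nonneg _
  have hmz : Measurable fun ω => ζ ω ⬝ᵥ ζ ω := by
    unfold dotProduct
    fun_prop
  have hmθ : ∀ θ : Fin d → ℝ, Measurable fun ω => θ ⬝ᵥ ζ ω := fun θ => by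
    unfold dotProduct
    fun_prop
  have hX : ∀ θ : Fin d → ℝ, ∀ ω, |θ ⬝ᵥ ζ ω| ≤ Real.sqrt (θ ⬝ᵥ θ) * K := fun θ ω =>
    abs_dotProduct_le_sqrt_mul θ (ζ ω) hK0.le ((hK ω).trans (by nlinarith))
  constructor
  · refine ⟨K, hK0.le, 1, one_pos, fun t ht => ?_⟩
    have hle : ∀ Q ∈ 𝒬, ∫ ω, Real.exp (t * (ζ ω ⬝ᵥ ζ ω)) ∂Q ≤ Real.exp (K * t) := fun Q hQ => by
      have := hprob Q hQ
      refine integral_le_of_forall_le (fun ω => (Real.exp_pos _).le) fun ω => ?_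
      rw [mul_comm K]
      exact Real.exp_le_exp.2 (mul_le_mul_of_nonneg_left (hK ω) ht.1)
    obtain ⟨Q, hQ⟩ := h𝒬
    have := hprob Q hQ
    have hpos : 0 < ∫ ω, Real.exp (t * (ζ ω ⬝ᵥ ζ ω)) ∂Q := by
      refine integral_exp_pos (integrable_of_abs_le (by fun_prop) (B := Real.exp (t * K)) ?_)
      intro ω
      rw [Real.abs_exp]
      exact Real.exp_le_exp.2 (mul_le_mul_of_nonneg_left (hK ω) ht.1)
    rw [Real.log_le_iff_le_exp
      (hpos.trans_le (le_biSup_of_mem_of_le (Real.exp_pos _).le hle hQ))]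
    exact Real.iSup_le (fun Q => Real.iSup_le (hle Q) (Real.exp_pos _).le) (Real.exp_pos _).le
  · intro C hC
    set b := δ / (2 * K) with hb
    have hb0 : 0 < b := by positivity
    set D := C + K
    have hD : 0 < D := by positivity
    refine ⟨(b / (4 * D)) ^ 2, by positivity, 1 + 4 * D / b ^ 2, by positivity, ?_⟩
    intro t ht θ hθ
    have hθθ : 0 ≤ θ ⬝ᵥ θ := Finset.sum_nonneg fun i _ => mul_self_nonneg _
    have hrsq := Real.sq_sqrt hθθ
    have hXθ := hX θ
    set r := Real.sqrt (θ ⬝ᵥ θ)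
    have hR : 0 < 4 * D / b ^ 2 := by positivity
    have hr1 : 1 ≤ r := by linarith
    have hr0 : 0 < r := by linarith
    have hu : Real.sqrt t ≤ b / (4 * D) := Real.sqrt_le_iff.2 ⟨by positivity, ht.2⟩
    have hu0 := Real.sqrt_nonneg t
    have hlog := mul_mul_le_log_cosh hb0 hD ht.1 hu (show 4 * D / b ^ 2 ≤ r by linarith)
    set u := Real.sqrt t
    obtain ⟨Q, hQ, hvar⟩ : ∃ Q ∈ 𝒬, δ / 2 * r ^ 2 ≤ ∫ ω, (θ ⬝ᵥ ζ ω) ^ 2 ∂Q := by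
      by_contra! hcon
      have h1 : ⨆ Q ∈ 𝒬, ∫ ω, (θ ⬝ᵥ ζ ω) ^ 2 ∂Q ≤ δ / 2 * r ^ 2 :=
        Real.iSup_le (fun Q => Real.iSup_le (fun hQ => (hcon Q hQ).le) (by positivity))
          (by positivity)
      have h2 := (hδ θ).trans h1
      rw [← hrsq] at h2
      have : 0 < δ * r ^ 2 := by positivity
      linarith
    have hQp := hprob Q hQ
    have hB : ∀ ω, |u * (θ ⬝ᵥ ζ ω)| ≤ u * (r * K) := fun ω => by
      rw [abs_mul, abs_of_nonneg hu0]
      exact mul_le_mul_of_nonneg_left (hXθ ω) hu0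
    have habs : b * r ≤ ∫ ω, |θ ⬝ᵥ ζ ω| ∂Q := by
      have h1 : ∫ ω, (θ ⬝ᵥ ζ ω) ^ 2 ∂Q ≤ ∫ ω, r * K * |θ ⬝ᵥ ζ ω| ∂Q := by
        have hi : Integrable (fun ω => |θ ⬝ᵥ ζ ω|) Q :=
          integrable_of_abs_le (by fun_prop) (B := r * K) (by simpa using hXθ)
        refine integral_mono_of_nonneg (Filter.Eventually.of_forall fun ω => sq_nonneg _)
          (hi.const_mul _) (Filter.Eventually.of_forall fun ω => ?_)
        change (θ ⬝ᵥ ζ ω) ^ 2 ≤ r * K * |θ ⬝ᵥ ζ ω|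
        rw [← sq_abs, sq]
        exact mul_le_mul_of_nonneg_right (hXθ ω) (abs_nonneg _)
      rw [integral_const_mul] at h1
      refine le_of_mul_le_mul_left ?_ (show 0 < r * K by positivity)
      refine le_trans (le_of_eq ?_) (hvar.trans h1)
      rw [hb]
      field_simp
    have hcosh : Real.cosh (b * u * r) ≤ ∫ ω, Real.exp (u * (θ ⬝ᵥ ζ ω)) ∂Q := by
      refine cosh_le_integral_exp Q (by fun_prop) hB (fun n => ?_) (by positivity) ?_
      · simp only [mul_pow]
        rw [integral_const_mul]
        have := hodd Q hQ θ (n + 1) (by omega)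
        rw [show 2 * (n + 1) - 1 = 2 * n + 1 by omega] at this
        rw [this, mul_zero]
      · simp only [abs_mul, abs_of_nonneg hu0]
        rw [integral_const_mul]
        nlinarith
    have hexp_le : ∀ ω, Real.exp (u * (θ ⬝ᵥ ζ ω) - t * (ζ ω ⬝ᵥ ζ ω)) ≤
        Real.exp (u * (r * K)) := fun ω =>
      Real.exp_le_exp.2 (by linarith [(le_abs_self _).trans (hB ω), mul_nonneg ht.1 (hz0 ω)])
    have hlow : Real.exp (-(K * t)) * Real.cosh (b * u * r) ≤
        ∫ ω, Real.exp (u * (θ ⬝ᵥ ζ ω) - t * (ζ ω ⬝ᵥ ζ ω)) ∂Q := by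
      refine (mul_le_mul_of_nonneg_left hcosh (Real.exp_pos _).le).trans ?_
      rw [← integral_const_mul]
      refine integral_mono_of_nonneg (Filter.Eventually.of_forall fun ω => by positivity)
        (integrable_of_abs_le (by fun_prop) (B := Real.exp (u * (r * K))) fun ω => ?_)
        (Filter.Eventually.of_forall fun ω => ?_)
      · rw [Real.abs_exp]
        exact hexp_le ω
      · change Real.exp (-(K * t)) * Real.exp (u * (θ ⬝ᵥ ζ ω)) ≤ _
        rw [← Real.exp_add]
        exact Real.exp_le_exp.2 (by nlinarith [mul_le_mul_of_nonneg_left (hK ω) ht.1])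
    have hupp : ∀ Q ∈ 𝒬, ∫ ω, Real.exp (u * (θ ⬝ᵥ ζ ω) - t * (ζ ω ⬝ᵥ ζ ω)) ∂Q ≤
        Real.exp (u * (r * K)) := fun Q hQ => by
      have := hprob Q hQ
      exact integral_le_of_forall_le (fun ω => (Real.exp_pos _).le) hexp_le
    have hsup := hlow.trans (le_biSup_of_mem_of_le (Real.exp_pos (u * (r * K))).le hupp hQ)
    have hcp := Real.cosh_pos (b * u * r)
    refine le_trans ?_ (Real.log_le_log (by positivity) hsup)
    rw [Real.log_mul (Real.exp_ne_zero _) hcp.ne', Real.log_exp]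
    have hKt : K * t ≤ K * r * t :=
      mul_le_mul_of_nonneg_right (le_mul_of_one_le_right hK0.le hr1) ht.1
    have hDe : D * r * t = C * r * t + K * r * t := by ring
    linarith
end

section
/- Let Q be a probability measure on a measurable space (Ω,𝔄) and X : Ω → ℝ a bounded measurable function such that ∫_Ω X^{2k−1} dQ = 0 for every integer k ≥ 1. Then ∫_Ω e^X dQ ≥ cosh( (∫_Ω X² dQ)^{1/2} ). -/
open MeasureTheory

open scoped Nat

section BoundedMoments

variable {Ω : Type*} [MeasurableSpace Ω] {μ : Measure Ω} {X : Ω → ℝ}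

lemma integrable_pow_of_abs_le [IsFiniteMeasure μ] (hX : Measurable X) {M : ℝ}
    (hM : ∀ ω, |X ω| ≤ M) (n : ℕ) : Integrable (fun ω ↦ X ω ^ n) μ := by
  refine Integrable.of_bound (hX.pow_const n).aestronglyMeasurable (M ^ n) (.of_forall fun ω ↦ ?_)
  rw [Real.norm_eq_abs, abs_pow]
  exact pow_le_pow_left₀ (abs_nonneg _) (hM ω) n

lemma hasSum_integral_pow_div_factorial [IsFiniteMeasure μ] (hX : Measurable X) {M : ℝ}
    (hM : ∀ ω, |X ω| ≤ M) :
    HasSum (fun n : ℕ ↦ (∫ ω, X ω ^ n ∂μ) / n !) (∫ ω, Real.exp (X ω) ∂μ) := by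
  simp_rw [← integral_div]
  refine hasSum_integral_of_dominated_convergence (fun n _ ↦ M ^ n / n !)
    (fun n ↦ ((hX.pow_const n).div_const _).aestronglyMeasurable)
    (fun n ↦ .of_forall fun ω ↦ ?_)
    (.of_forall fun _ ↦ Real.summable_pow_div_factorial M)
    (integrable_const _) (.of_forall fun ω ↦ ?_)
  · rw [norm_div, norm_pow, Real.norm_eq_abs, Real.norm_natCast]
    gcongr
    exact hM ω
  · rw [Real.exp_eq_exp_ℝ]
    exact NormedSpace.expSeries_div_hasSum_exp (X ω)

lemma integral_sq_pow_le [IsProbabilityMeasure μ] (hX : Measurable X) {M : ℝ}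
    (hM : ∀ ω, |X ω| ≤ M) (n : ℕ) :
    (∫ ω, X ω ^ 2 ∂μ) ^ n ≤ ∫ ω, X ω ^ (2 * n) ∂μ := by
  simp_rw [pow_mul]
  exact (convexOn_pow n).map_integral_le (continuous_pow n).continuousOn isClosed_Ici
    (.of_forall fun ω ↦ sq_nonneg (X ω)) (integrable_pow_of_abs_le hX hM 2)
    (by simpa only [Function.comp_def, ← pow_mul] using integrable_pow_of_abs_le hX hM (2 * n))

end BoundedMoments

/-- Let `Q` be a probability measure and `X` a bounded measurable
function whose odd moments all vanish. Then
`∫ e^X dQ ≥ cosh( (∫ X² dQ)^{1/2} )`. -/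
theorem stmt_12 {Ω : Type*} [MeasurableSpace Ω] (Q : Measure Ω) [IsProbabilityMeasure Q]
    (X : Ω → ℝ) (hXm : Measurable X) (hXb : ∃ M : ℝ, ∀ ω, |X ω| ≤ M)
    (hodd : ∀ k : ℕ, 1 ≤ k → ∫ ω, X ω ^ (2 * k - 1) ∂Q = 0) :
    Real.cosh (Real.sqrt (∫ ω, X ω ^ 2 ∂Q)) ≤ ∫ ω, Real.exp (X ω) ∂Q := by
  obtain ⟨M, hM⟩ := hXb
  have heven : HasSum (fun n : ℕ ↦ (∫ ω, X ω ^ (2 * n) ∂Q) / (2 * n)!)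
      (∫ ω, Real.exp (X ω) ∂Q) := by
    refine (Function.Injective.hasSum_iff (mul_right_injective₀ two_ne_zero) fun m hm ↦ ?_).mpr
      (hasSum_integral_pow_div_factorial hXm hM)
    obtain ⟨k, rfl | rfl⟩ := m.even_or_odd'
    · exact absurd ⟨k, rfl⟩ hm
    · have h := hodd (k + 1) (by omega)
      rw [show 2 * (k + 1) - 1 = 2 * k + 1 by omega] at h
      rw [h, zero_div]
  refine hasSum_le (fun n ↦ ?_) (Real.hasSum_cosh _) heven
  rw [pow_mul, Real.sq_sqrt (integral_nonneg fun ω ↦ sq_nonneg (X ω))]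
  gcongr
  exact integral_sq_pow_le hXm hM n
end

section
/- For every C ≥ 0 there exist t₀ > 0 and R ≥ 0 such that log(cosh(√t · x)) ≥ C t x for all t ∈ [0,t₀] and all real x ≥ R. -/
lemma Real.sq_div_six_le_log_cosh {y : ℝ} (h0 : 0 ≤ y) (h2 : y ≤ 2) :
    y ^ 2 / 6 ≤ Real.log (Real.cosh y) := by
  have hsinh : y / 2 ≤ Real.sinh (y / 2) := Real.self_le_sinh_iff.2 (by linarith)
  have hcosh : 1 + y ^ 2 / 2 ≤ Real.cosh y := by
    have h1 := Real.cosh_two_mul (y / 2)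
    have h3 := Real.cosh_sq (y / 2)
    rw [show 2 * (y / 2) = y by ring] at h1
    nlinarith
  have hpos : 0 < 1 + y ^ 2 / 2 := by positivity
  calc y ^ 2 / 6 ≤ 1 - (1 + y ^ 2 / 2)⁻¹ := by
        rw [← sub_nonneg, show 1 - (1 + y ^ 2 / 2)⁻¹ - y ^ 2 / 6
          = y ^ 2 * (4 - y ^ 2) / (12 * (1 + y ^ 2 / 2)) by field_simp; ring]
        have : 0 ≤ 4 - y ^ 2 := by nlinarith
        positivity
    _ ≤ Real.log (1 + y ^ 2 / 2) := Real.one_sub_inv_le_log_of_pos hpos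
    _ ≤ Real.log (Real.cosh y) := Real.log_le_log hpos hcosh

lemma Real.sub_log_two_le_log_cosh (y : ℝ) :
    y - Real.log 2 ≤ Real.log (Real.cosh y) := by
  rw [Real.le_log_iff_exp_le (Real.cosh_pos y), Real.exp_sub, Real.exp_log two_pos,
    Real.cosh_eq]
  linarith [Real.exp_pos (-y)]

/-- For every `C ≥ 0` there exist `t₀ > 0` and `R ≥ 0` such that
`log(cosh(√t · x)) ≥ C t x` for all `t ∈ [0,t₀]` and all real `x ≥ R`. -/
theorem stmt_13 :
    ∀ C : ℝ, 0 ≤ C → ∃ t₀ > (0 : ℝ), ∃ R ≥ (0 : ℝ),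
      ∀ t ∈ Set.Icc (0 : ℝ) t₀, ∀ x : ℝ, R ≤ x →
        C * t * x ≤ Real.log (Real.cosh (Real.sqrt t * x)) := by
  intro C hC
  refine ⟨(1 / (2 * C + 1)) ^ 2, by positivity, 6 * C, by positivity, ?_⟩
  rintro t ⟨ht0, ht⟩ x hx
  have hs0 : 0 ≤ √t := Real.sqrt_nonneg t
  have hs : √t ≤ 1 / (2 * C + 1) := Real.sqrt_le_iff.2 ⟨by positivity, ht⟩
  have hCs : C * √t ≤ 1 / 2 := by
    rw [le_div_iff₀ (by positivity)] at hs
    nlinarith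
  have hy0 : 0 ≤ √t * x := mul_nonneg hs0 (by linarith)
  have hsq : C * t * x = C * √t * (√t * x) := by
    linear_combination -(C * x) * Real.sq_sqrt ht0
  rw [hsq]
  rcases le_total (√t * x) 2 with hy | hy
  · refine le_trans ?_ (Real.sq_div_six_le_log_cosh hy0 hy)
    nlinarith [mul_nonneg (mul_nonneg hs0 hy0) (sub_nonneg.2 hx)]
  · refine le_trans ?_ (Real.sub_log_two_le_log_cosh _)
    nlinarith [Real.log_two_lt_d9]
end

section
/- Let Λ be a nonempty bounded set of positive semidefinite symmetric real d×d matrices and define E[g] := sup_{Σ∈Λ} ∫_{ℝ^d} g(x) dN(0,Σ)(x). Then condition (mgf1) holds for E with ζ the identity map on ℝ^d. If moreover there exists δ > 0 with sup_{Σ∈Λ} θᵀΣθ ≥ δ|θ|² for all θ ∈ ℝ^d, then condition (mgf2) also holds. -/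
open MeasureTheory Matrix ProbabilityTheory

/-- If `A Aᵀ ≤ M` as quadratic forms, then also `Aᵀ A ≤ M`. -/
lemma mulVec_dotProduct_self_le {m n : Type*} [Fintype m] [Fintype n]
    (A : Matrix m n ℝ) {M : ℝ} (hM : 0 ≤ M)
    (h : ∀ x : m → ℝ, x ⬝ᵥ (A * Aᵀ).mulVec x ≤ M * (x ⬝ᵥ x)) (y : n → ℝ) :
    A.mulVec y ⬝ᵥ A.mulVec y ≤ M * (y ⬝ᵥ y) := by
  set x := A.mulVec y with hx
  set z := Aᵀ.mulVec x with hz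
  have hzz : z ⬝ᵥ z ≤ M * (x ⬝ᵥ x) := by
    refine le_trans (le_of_eq ?_) (h x)
    rw [← mulVec_mulVec, ← hz, dotProduct_mulVec x, ← mulVec_transpose]
  have hyz : x ⬝ᵥ x = z ⬝ᵥ y := by
    rw [hz, mulVec_transpose, ← dotProduct_mulVec]
  have hcs : (z ⬝ᵥ y) ^ 2 ≤ (z ⬝ᵥ z) * (y ⬝ᵥ y) := by
    simpa [dotProduct, sq] using Finset.sum_mul_sq_le_sq_mul_sq Finset.univ z y
  have hx0 : 0 ≤ x ⬝ᵥ x := by simpa using dotProduct_star_self_nonneg x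
  have hy0 : 0 ≤ y ⬝ᵥ y := by simpa using dotProduct_star_self_nonneg y
  rcases hx0.eq_or_lt with h0 | hpos
  · rw [← h0]; positivity
  · rw [← hyz] at hcs
    have := mul_le_mul_of_nonneg_right hzz hy0
    refine le_of_mul_le_mul_left ?_ hpos
    nlinarith

lemma exists_integrable_exp_mul_dotProduct_self_pi_gaussianReal (ι : Type*) [Fintype ι] :
    ∃ s > (0 : ℝ), Integrable (fun y : ι → ℝ => Real.exp (s * (y ⬝ᵥ y)))
      (Measure.pi fun _ : ι => gaussianReal 0 1) := by
  obtain ⟨s, hs, hint⟩ := IsGaussian.exists_integrable_exp_sq (gaussianReal 0 1)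
  refine ⟨s, hs, ?_⟩
  have := Integrable.fintype_prod (μ := fun _ : ι => gaussianReal 0 1) (fun _ : ι => hint)
  refine this.congr (ae_of_all _ fun y => ?_)
  simp only [Real.norm_eq_abs, sq_abs, ← Real.exp_sum, dotProduct, Finset.mul_sum, ← sq]

lemma integrable_exp_dotProduct_pi_gaussianReal {ι : Type*} [Fintype ι] (w : ι → ℝ) :
    Integrable (fun y : ι → ℝ => Real.exp (w ⬝ᵥ y))
      (Measure.pi fun _ : ι => gaussianReal 0 1) := by
  have := Integrable.fintype_prod (μ := fun _ : ι => gaussianReal 0 1)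
    (fun i : ι => integrable_exp_mul_gaussianReal (μ := 0) (v := 1) (w i))
  refine this.congr (ae_of_all _ fun y => ?_)
  simp only [← Real.exp_sum, dotProduct]

lemma integral_exp_dotProduct_pi_gaussianReal {ι : Type*} [Fintype ι] (w : ι → ℝ) :
    ∫ y : ι → ℝ, Real.exp (w ⬝ᵥ y) ∂(Measure.pi fun _ : ι => gaussianReal 0 1) =
      Real.exp ((w ⬝ᵥ w) / 2) := by
  simp only [dotProduct, Real.exp_sum]
  rw [integral_fintype_prod_eq_prod (fun i x => Real.exp (w i * x))]
  have h (i : ι) : ∫ x, Real.exp (w i * x) ∂(gaussianReal 0 1) = Real.exp (w i * w i / 2) := by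
    have := congrFun (mgf_id_gaussianReal (μ := 0) (v := 1)) (w i)
    simpa [mgf, sq] using this
  simp only [h, ← Real.exp_sum, Finset.sum_div]

lemma exp_mul_le_one_add_mul_exp {τ : ℝ} (h0 : 0 ≤ τ) (h1 : τ ≤ 1) (x : ℝ) :
    Real.exp (τ * x) ≤ 1 + τ * Real.exp x := by
  have := convexOn_exp.2 (Set.mem_univ x) (Set.mem_univ 0) h0 (sub_nonneg.2 h1) (by ring)
  simp only [smul_eq_mul, mul_zero, add_zero, Real.exp_zero, mul_one] at this
  linarith

/-- Bound on the moment generating function of `|A y|²` that is uniform over all `A` with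
`|A y|² ≤ M |y|²`. -/
lemma exists_integral_exp_mul_mulVec_dotProduct_self_le (m n : Type*) [Fintype m] [Fintype n]
    {M : ℝ} (hM : 0 < M) :
    ∃ K ≥ (0 : ℝ), ∃ t₁ > (0 : ℝ), ∀ A : Matrix m n ℝ,
      (∀ y, A.mulVec y ⬝ᵥ A.mulVec y ≤ M * (y ⬝ᵥ y)) → ∀ t ∈ Set.Icc (0 : ℝ) t₁,
      Integrable (fun y => Real.exp (t * (A.mulVec y ⬝ᵥ A.mulVec y)))
        (Measure.pi fun _ : n => gaussianReal 0 1) ∧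
      ∫ y, Real.exp (t * (A.mulVec y ⬝ᵥ A.mulVec y))
        ∂(Measure.pi fun _ : n => gaussianReal 0 1) ≤ Real.exp (K * t) := by
  obtain ⟨s, hs, hint⟩ := exists_integrable_exp_mul_dotProduct_self_pi_gaussianReal n
  set γ := Measure.pi fun _ : n => gaussianReal 0 1 with hγ
  set J := ∫ y : n → ℝ, Real.exp (s * (y ⬝ᵥ y)) ∂γ with hJ
  have hJ0 : 0 ≤ J := integral_nonneg fun _ => (Real.exp_pos _).le
  refine ⟨M / s * J, by positivity, s / M, by positivity, fun A hA t ⟨ht0, ht1⟩ => ?_⟩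
  set τ := t * M / s with hτ
  have hτ0 : 0 ≤ τ := by positivity
  have hτ1 : τ ≤ 1 := by
    rw [hτ, div_le_one hs]
    rwa [le_div_iff₀ hM] at ht1
  have hle (y : n → ℝ) : Real.exp (t * (A.mulVec y ⬝ᵥ A.mulVec y)) ≤
      1 + τ * Real.exp (s * (y ⬝ᵥ y)) := by
    refine le_trans (Real.exp_le_exp.2 ?_) (exp_mul_le_one_add_mul_exp hτ0 hτ1 _)
    calc t * (A.mulVec y ⬝ᵥ A.mulVec y) ≤ t * (M * (y ⬝ᵥ y)) := by gcongr; exact hA y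
      _ = τ * (s * (y ⬝ᵥ y)) := by rw [hτ]; field_simp
  have hbd : Integrable (fun y : n → ℝ => 1 + τ * Real.exp (s * (y ⬝ᵥ y))) γ :=
    (integrable_const 1).add (hint.const_mul τ)
  have hi : Integrable (fun y => Real.exp (t * (A.mulVec y ⬝ᵥ A.mulVec y))) γ := by
    refine hbd.mono' (Continuous.aestronglyMeasurable (by fun_prop)) (ae_of_all _ fun y => ?_)
    rw [Real.norm_eq_abs, Real.abs_exp]
    exact hle y
  refine ⟨hi, (integral_mono hi hbd hle).trans ?_⟩
  rw [integral_add (integrable_const 1) (hint.const_mul τ), integral_const_mul, ← hJ]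
  simp only [integral_const, probReal_univ, smul_eq_mul, mul_one]
  have h1 : M / s * J * t = τ * J := by rw [hτ]; ring
  rw [h1, add_comm]
  exact Real.add_one_le_exp _

/-- A weighted arithmetic-geometric mean form of the Cauchy-Schwarz inequality. -/
lemma exp_le_integral_exp_of_integral_exp_half {Ω : Type*} [MeasurableSpace Ω] {μ : Measure Ω}
    {p v : Ω → ℝ} {g k : ℝ} (hp : Integrable (fun ω => Real.exp (p ω)) μ)
    (hv : Integrable (fun ω => Real.exp (v ω)) μ)
    (hu : Integrable (fun ω => Real.exp ((p ω + v ω) / 2)) μ)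
    (hg : Real.exp g ≤ ∫ ω, Real.exp ((p ω + v ω) / 2) ∂μ)
    (hk : ∫ ω, Real.exp (v ω) ∂μ ≤ Real.exp k) :
    Real.exp (2 * g - k) ≤ ∫ ω, Real.exp (p ω) ∂μ := by
  have hpt (ω : Ω) : Real.exp ((p ω + v ω) / 2) ≤
      (Real.exp (k - g) * Real.exp (p ω) + Real.exp (g - k) * Real.exp (v ω)) / 2 := by
    rw [← Real.exp_add, ← Real.exp_add]
    have h1 : (p ω + v ω) / 2 = (k - g + p ω) / 2 + (g - k + v ω) / 2 := by ring
    have h2 : Real.exp (k - g + p ω) = Real.exp ((k - g + p ω) / 2) ^ 2 := by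
      rw [← Real.exp_nat_mul]; congr 1; push_cast; ring
    have h3 : Real.exp (g - k + v ω) = Real.exp ((g - k + v ω) / 2) ^ 2 := by
      rw [← Real.exp_nat_mul]; congr 1; push_cast; ring
    rw [h1, Real.exp_add, h2, h3]
    nlinarith [sq_nonneg (Real.exp ((k - g + p ω) / 2) - Real.exp ((g - k + v ω) / 2))]
  have hmono := integral_mono hu
    (((hp.const_mul (Real.exp (k - g))).add (hv.const_mul (Real.exp (g - k)))).div_const 2) hpt
  simp only [Pi.add_apply] at hmono
  rw [integral_div, integral_add (hp.const_mul _) (hv.const_mul _), integral_const_mul,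
    integral_const_mul] at hmono
  have hvk := mul_le_mul_of_nonneg_left hk (Real.exp_pos (g - k)).le
  rw [← Real.exp_add, sub_add_cancel] at hvk
  have hfin : Real.exp g ≤ Real.exp (k - g) * ∫ ω, Real.exp (p ω) ∂μ := by linarith
  have h4 : Real.exp g = Real.exp (k - g) * Real.exp (2 * g - k) := by
    rw [← Real.exp_add]; congr 1; ring
  rw [h4] at hfin
  exact le_of_mul_le_mul_left hfin (Real.exp_pos _)

lemma sqrt_mul_dotProduct_sub_le {n : Type*} [Fintype n] {t : ℝ} (ht : 0 ≤ t) (θ x : n → ℝ) :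
    Real.sqrt t * (θ ⬝ᵥ x) - t * (x ⬝ᵥ x) ≤ θ ⬝ᵥ θ := by
  simp only [dotProduct, Finset.mul_sum, ← Finset.sum_sub_distrib]
  refine Finset.sum_le_sum fun i _ => ?_
  nlinarith [Real.sq_sqrt ht, sq_nonneg (Real.sqrt t * x i - θ i / 2), sq_nonneg (θ i)]

lemma bddAbove_range_biSup_real {α : Type*} {s : Set α} {f : α → ℝ} {B : ℝ}
    (hf : ∀ a ∈ s, f a ≤ B) (hB : 0 ≤ B) :
    BddAbove (Set.range fun a => ⨆ _ : a ∈ s, f a) :=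
  ⟨B, by rintro _ ⟨a, rfl⟩; exact Real.iSup_le (hf a) hB⟩

lemma le_biSup_real {α : Type*} {s : Set α} {f : α → ℝ} {B : ℝ}
    (hf : ∀ a ∈ s, f a ≤ B) (hB : 0 ≤ B) {a : α} (ha : a ∈ s) :
    f a ≤ ⨆ a ∈ s, f a := by
  refine le_ciSup_of_le (bddAbove_range_biSup_real hf hB) a ?_
  simp [ha]

/-- Lower bound on `E[exp(√t θᵀζ - t|ζ|²)]` for the centered Gaussian with covariance `A Aᵀ`. -/
lemma exp_le_integral_exp_sqrt_mul_dotProduct_mulVec_sub {m n : Type*} [Fintype m] [Fintype n]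
    (A : Matrix m n ℝ) {t K : ℝ} (ht : 0 ≤ t) (θ : m → ℝ)
    (hi : Integrable (fun y => Real.exp (t * (A.mulVec y ⬝ᵥ A.mulVec y)))
        (Measure.pi fun _ : n => gaussianReal 0 1))
    (hK : ∫ y, Real.exp (t * (A.mulVec y ⬝ᵥ A.mulVec y))
        ∂(Measure.pi fun _ : n => gaussianReal 0 1) ≤ Real.exp (K * t)) :
    Real.exp (t * (θ ⬝ᵥ (A * Aᵀ).mulVec θ / 4 - K)) ≤
      ∫ y, Real.exp (Real.sqrt t * (θ ⬝ᵥ A.mulVec y) - t * (A.mulVec y ⬝ᵥ A.mulVec y))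
        ∂(Measure.pi fun _ : n => gaussianReal 0 1) := by
  set w : n → ℝ := (Real.sqrt t / 2) • Aᵀ.mulVec θ with hw
  have hwy (y : n → ℝ) : (Real.sqrt t * (θ ⬝ᵥ A.mulVec y) - t * (A.mulVec y ⬝ᵥ A.mulVec y) +
      t * (A.mulVec y ⬝ᵥ A.mulVec y)) / 2 = w ⬝ᵥ y := by
    rw [hw, smul_dotProduct, mulVec_transpose, ← dotProduct_mulVec, smul_eq_mul]
    ring
  have hww : w ⬝ᵥ w = t / 4 * (θ ⬝ᵥ (A * Aᵀ).mulVec θ) := by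
    rw [← mulVec_mulVec, dotProduct_mulVec θ, ← mulVec_transpose, hw, smul_dotProduct,
      dotProduct_smul, smul_eq_mul, smul_eq_mul, ← mul_assoc]
    congr 1
    linear_combination (1 / 4 : ℝ) * Real.mul_self_sqrt ht
  have key := exp_le_integral_exp_of_integral_exp_half
    (μ := Measure.pi fun _ : n => gaussianReal 0 1)
    (p := fun y => Real.sqrt t * (θ ⬝ᵥ A.mulVec y) - t * (A.mulVec y ⬝ᵥ A.mulVec y))
    (v := fun y => t * (A.mulVec y ⬝ᵥ A.mulVec y)) (g := (w ⬝ᵥ w) / 2) (k := K * t)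
    ?_ hi ?_ ?_ hK
  · refine le_trans (le_of_eq ?_) key
    rw [hww]
    congr 1
    ring
  · refine (integrable_const (Real.exp (θ ⬝ᵥ θ))).mono'
      (Continuous.aestronglyMeasurable (by fun_prop)) (ae_of_all _ fun y => ?_)
    rw [Real.norm_eq_abs, Real.abs_exp]
    exact Real.exp_le_exp.2 (sqrt_mul_dotProduct_sub_le ht θ _)
  · simp only [hwy]
    exact integrable_exp_dotProduct_pi_gaussianReal w
  · simp only [hwy]
    exact (integral_exp_dotProduct_pi_gaussianReal w).ge

/-- Let `Λ` be a nonempty bounded set of positive semidefinite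
symmetric `d×d` matrices and `E[g] := sup_{Σ∈Λ} ∫ g dN(0,Σ)`, where `N(0,Σ)` is
the centered Gaussian with covariance `Σ` (realized as pushforward of the
standard Gaussian product measure under `x ↦ Ax` with `AAᵀ = Σ`). Then (mgf1)
holds for `E` with `ζ = id`; if moreover `sup_{Σ∈Λ} θᵀΣθ ≥ δ|θ|²` for some
`δ > 0`, then (mgf2) also holds. -/
theorem stmt_15 {d : ℕ}
    (Λ : Set (Matrix (Fin d) (Fin d) ℝ)) (hne : Λ.Nonempty)
    (hpsd : ∀ S ∈ Λ, S.PosSemidef)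
    (hbdd : ∃ M : ℝ, ∀ S ∈ Λ, ∀ x : Fin d → ℝ, x ⬝ᵥ S.mulVec x ≤ M * (x ⬝ᵥ x))
    (N : Matrix (Fin d) (Fin d) ℝ → Measure (Fin d → ℝ))
    (hN : ∀ S ∈ Λ, ∃ A : Matrix (Fin d) (Fin d) ℝ, A * Aᵀ = S ∧
      N S = Measure.map (fun y => A.mulVec y)
        (Measure.pi fun _ : Fin d => gaussianReal 0 1)) :
    (∃ M ≥ (0 : ℝ), ∃ t₁ > (0 : ℝ), ∀ t ∈ Set.Icc (0 : ℝ) t₁,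
        Real.log (⨆ S ∈ Λ, ∫ x, Real.exp (t * (x ⬝ᵥ x)) ∂(N S)) ≤ M * t) ∧
    ((∃ δ > (0 : ℝ), ∀ θ : Fin d → ℝ, δ * (θ ⬝ᵥ θ) ≤ ⨆ S ∈ Λ, θ ⬝ᵥ S.mulVec θ) →
      ∀ C ≥ (0 : ℝ), ∃ t₂ > (0 : ℝ), ∃ R ≥ (0 : ℝ),
        ∀ t ∈ Set.Icc (0 : ℝ) t₂, ∀ θ : Fin d → ℝ, R ≤ Real.sqrt (θ ⬝ᵥ θ) →
          C * Real.sqrt (θ ⬝ᵥ θ) * t ≤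
            Real.log (⨆ S ∈ Λ,
              ∫ x, Real.exp (Real.sqrt t * (θ ⬝ᵥ x) - t * (x ⬝ᵥ x)) ∂(N S))) := by
  obtain ⟨M₀, hM₀⟩ := hbdd
  set M := max M₀ 1 with hMdef
  have hM : 0 < M := lt_max_of_lt_right one_pos
  have hself (x : Fin d → ℝ) : 0 ≤ x ⬝ᵥ x := by simpa using dotProduct_star_self_nonneg x
  have hSM : ∀ S ∈ Λ, ∀ x : Fin d → ℝ, x ⬝ᵥ S.mulVec x ≤ M * (x ⬝ᵥ x) := fun S hS x =>
    (hM₀ S hS x).trans (mul_le_mul_of_nonneg_right (le_max_left _ _) (hself x))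
  obtain ⟨K, hK, t₁, ht₁, hmgf⟩ :=
    exists_integral_exp_mul_mulVec_dotProduct_self_le (Fin d) (Fin d) hM
  have hmap (A : Matrix (Fin d) (Fin d) ℝ) (f : (Fin d → ℝ) → ℝ) (hf : Continuous f) :
      ∫ x, f x ∂(Measure.map (fun y => A.mulVec y)
        (Measure.pi fun _ : Fin d => gaussianReal 0 1)) =
      ∫ y, f (A.mulVec y) ∂(Measure.pi fun _ : Fin d => gaussianReal 0 1) :=
    integral_map (Continuous.aemeasurable (by fun_prop)) hf.aestronglyMeasurable
  have hA : ∀ S ∈ Λ, ∀ A : Matrix (Fin d) (Fin d) ℝ, A * Aᵀ = S →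
      ∀ y, A.mulVec y ⬝ᵥ A.mulVec y ≤ M * (y ⬝ᵥ y) := fun S hS A hAS =>
    mulVec_dotProduct_self_le A hM.le (hAS ▸ hSM S hS)
  refine ⟨⟨K, hK, t₁, ht₁, fun t ht => ?_⟩, ?_⟩
  · have hle : (⨆ S ∈ Λ, ∫ x, Real.exp (t * (x ⬝ᵥ x)) ∂(N S)) ≤ Real.exp (K * t) := by
      refine Real.iSup_le (fun S => Real.iSup_le (fun hS => ?_) (Real.exp_pos _).le)
        (Real.exp_pos _).le
      obtain ⟨A, hAS, hNS⟩ := hN S hS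
      rw [hNS, hmap A _ (by fun_prop)]
      exact (hmgf A (hA S hS A hAS) t ht).2
    have h0 : 0 ≤ ⨆ S ∈ Λ, ∫ x, Real.exp (t * (x ⬝ᵥ x)) ∂(N S) :=
      Real.iSup_nonneg fun S => Real.iSup_nonneg fun _ =>
        integral_nonneg fun _ => (Real.exp_pos _).le
    rcases h0.eq_or_lt with h0 | hpos
    · rw [← h0, Real.log_zero]
      exact mul_nonneg hK ht.1
    · exact (Real.log_le_iff_le_exp hpos).2 hle
  · rintro ⟨δ, hδ, hΛ⟩ C hC
    refine ⟨t₁, ht₁, 1 + 8 * (C + K) / δ, by positivity, fun t ht θ hθ => ?_⟩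
    set r := Real.sqrt (θ ⬝ᵥ θ) with hr
    have hr1 : 1 ≤ r := le_trans (le_add_of_nonneg_right (by positivity)) hθ
    have hrr : θ ⬝ᵥ θ = r ^ 2 := (Real.sq_sqrt (hself θ)).symm
    obtain ⟨S, hS, hSθ⟩ : ∃ S ∈ Λ, δ / 2 * (θ ⬝ᵥ θ) < θ ⬝ᵥ S.mulVec θ := by
      by_contra! hcon
      have h1 := (hΛ θ).trans (Real.iSup_le
        (fun S => Real.iSup_le (hcon S) (by rw [hrr]; positivity)) (by rw [hrr]; positivity))
      rw [hrr] at h1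
      have : 0 < δ * r ^ 2 := by positivity
      linarith
    have hub : ∀ S ∈ Λ, ∫ x, Real.exp (Real.sqrt t * (θ ⬝ᵥ x) - t * (x ⬝ᵥ x)) ∂(N S) ≤
        Real.exp (θ ⬝ᵥ θ) := by
      intro S hS
      obtain ⟨A, -, hNS⟩ := hN S hS
      rw [hNS, hmap A _ (by fun_prop)]
      refine (integral_mono_of_nonneg (ae_of_all _ fun _ => (Real.exp_pos _).le)
        (integrable_const (Real.exp (θ ⬝ᵥ θ))) (ae_of_all _ fun y =>
          Real.exp_le_exp.2 (sqrt_mul_dotProduct_sub_le ht.1 θ _))).trans (le_of_eq ?_)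
      simp
    have hsup := le_biSup_real hub (Real.exp_pos _).le hS
    obtain ⟨A, hAS, hNS⟩ := hN S hS
    obtain ⟨hi, hKt⟩ := hmgf A (hA S hS A hAS) t ht
    have hlow := exp_le_integral_exp_sqrt_mul_dotProduct_mulVec_sub A ht.1 θ hi hKt
    rw [hNS, hmap A _ (by fun_prop)] at hsup
    have hfin := hlow.trans hsup
    rw [Real.le_log_iff_exp_le ((Real.exp_pos _).trans_le hfin)]
    refine le_trans (Real.exp_le_exp.2 ?_) hfin
    rw [hAS, mul_comm _ t]
    refine mul_le_mul_of_nonneg_left ?_ ht.1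
    have h8 : 8 * (C + K) ≤ r * δ := by
      rw [← div_le_iff₀ hδ]
      linarith
    rw [hrr] at hSθ
    nlinarith [mul_le_mul_of_nonneg_left h8 (zero_le_one.trans hr1),
      mul_le_mul_of_nonneg_left hr1 hK]
end

section
/- Let 𝒬 be a nonempty set of Borel probability measures on ℝ^d with K := sup_{Q∈𝒬} ∫_{ℝ^d} |x|² dQ(x) < ∞, and suppose there exists δ > 0 with sup_{Q∈𝒬} ∫_{ℝ^d} (θᵀx)² dQ(x) ≥ δ|θ|² for all θ ∈ ℝ^d. Let a be a symmetric real d×d matrix with operator norm ‖a‖, let b, μ ∈ ℝ^d, and α > 0. Then for every θ ∈ ℝ^d: (1/2) sup_{Q∈𝒬} ∫_{ℝ^d} ( xᵀax + α((b−θ)ᵀx)² ) dQ(x) + (b−θ)ᵀμ ≥ (αδ/2)|θ|² − ( α|b|K + |μ| )|θ| − ( (1/2)(α|b|² + ‖a‖)K + |b||μ| ). -/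
open MeasureTheory Matrix

theorem Real.le_biSup_of_forall_le {ι : Type*} {s : Set ι} {f : ι → ℝ} {B : ℝ}
    (hB : ∀ i ∈ s, f i ≤ B) {i : ι} (hi : i ∈ s) : f i ≤ ⨆ j ∈ s, f j := by
  have hbdd : BddAbove (Set.range fun j => ⨆ _ : j ∈ s, f j) := by
    refine ⟨max B 0, ?_⟩
    rintro _ ⟨j, rfl⟩
    exact Real.iSup_le (fun hj => (hB j hj).trans (le_max_left _ _)) (le_max_right _ _)
  simpa [hi] using le_ciSup hbdd i

theorem dotProduct_self_nonneg_real {ι : Type*} [Fintype ι] (u : ι → ℝ) : 0 ≤ u ⬝ᵥ u :=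
  Finset.sum_nonneg fun i _ => mul_self_nonneg (u i)

theorem sq_dotProduct_le {ι : Type*} [Fintype ι] (u v : ι → ℝ) :
    (u ⬝ᵥ v) ^ 2 ≤ (u ⬝ᵥ u) * (v ⬝ᵥ v) := by
  simpa only [dotProduct, sq] using Finset.sum_mul_sq_le_sq_mul_sq Finset.univ u v

theorem abs_dotProduct_le_sqrt_mul_sqrt {ι : Type*} [Fintype ι] (u v : ι → ℝ) :
    |u ⬝ᵥ v| ≤ √(u ⬝ᵥ u) * √(v ⬝ᵥ v) := by
  rw [← Real.sqrt_mul (dotProduct_self_nonneg_real u)]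
  exact Real.abs_le_sqrt (sq_dotProduct_le u v)

theorem sq_dotProduct_le_sq_dotProduct_sub_add {ι : Type*} [Fintype ι] (b θ x : ι → ℝ) :
    (θ ⬝ᵥ x) ^ 2 ≤ ((b - θ) ⬝ᵥ x) ^ 2 + 2 * (√(b ⬝ᵥ b) * √(θ ⬝ᵥ θ)) * (x ⬝ᵥ x) := by
  have h : (b ⬝ᵥ x) * (θ ⬝ᵥ x) ≤ √(b ⬝ᵥ b) * √(θ ⬝ᵥ θ) * (x ⬝ᵥ x) := calc
    (b ⬝ᵥ x) * (θ ⬝ᵥ x) ≤ |b ⬝ᵥ x| * |θ ⬝ᵥ x| := by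
      rw [← abs_mul]; exact le_abs_self _
    _ ≤ (√(b ⬝ᵥ b) * √(x ⬝ᵥ x)) * (√(θ ⬝ᵥ θ) * √(x ⬝ᵥ x)) := by
      gcongr <;> exact abs_dotProduct_le_sqrt_mul_sqrt _ _
    _ = √(b ⬝ᵥ b) * √(θ ⬝ᵥ θ) * (√(x ⬝ᵥ x) * √(x ⬝ᵥ x)) := by ring
    _ = _ := by rw [Real.mul_self_sqrt (dotProduct_self_nonneg_real x)]
  rw [sub_dotProduct]
  nlinarith [sq_nonneg (b ⬝ᵥ x)]

theorem integrable_sq_dotProduct {ι : Type*} [Fintype ι] {Q : Measure (ι → ℝ)}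
    (hQ : Integrable (fun x : ι → ℝ => x ⬝ᵥ x) Q) (u : ι → ℝ) :
    Integrable (fun x : ι → ℝ => (u ⬝ᵥ x) ^ 2) Q := by
  have hc : Continuous fun x : ι → ℝ => (u ⬝ᵥ x) ^ 2 := by
    simp only [dotProduct]; fun_prop
  refine (hQ.const_mul (u ⬝ᵥ u)).mono' hc.aestronglyMeasurable (.of_forall fun x => ?_)
  rw [Real.norm_of_nonneg (sq_nonneg _)]
  exact sq_dotProduct_le u x

theorem integrable_dotProduct_mulVec {ι : Type*} [Fintype ι] {Q : Measure (ι → ℝ)}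
    (hQ : Integrable (fun x : ι → ℝ => x ⬝ᵥ x) Q) {a : Matrix ι ι ℝ} {c : ℝ}
    (hc : ∀ x : ι → ℝ, |x ⬝ᵥ a.mulVec x| ≤ c * (x ⬝ᵥ x)) :
    Integrable (fun x : ι → ℝ => x ⬝ᵥ a.mulVec x) Q := by
  have hcont : Continuous fun x : ι → ℝ => x ⬝ᵥ a.mulVec x := by
    simp only [dotProduct, mulVec]; fun_prop
  exact (hQ.const_mul c).mono' hcont.aestronglyMeasurable (.of_forall hc)

/-- Coercivity of the generator component
`G_θ(a,b) = (1/2) sup_Q ∫ (xᵀax + α((b−θ)ᵀx)²) dQ + (b−θ)ᵀμ`. Under a uniform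
second-moment bound `K` and non-degeneracy `sup_Q ∫ (θᵀx)² dQ ≥ δ|θ|²`, for a
symmetric matrix `a` with operator norm (at most) `na`, one has for every `θ`:
`G_θ(a,b) ≥ (αδ/2)|θ|² − (α|b|K + |μ|)|θ| − ((1/2)(α|b|² + na)K + |b||μ|)`. -/
theorem stmt_18 {d : ℕ}
    (𝒬 : Set (Measure (Fin d → ℝ))) (hne : 𝒬.Nonempty)
    (hprob : ∀ Q ∈ 𝒬, IsProbabilityMeasure Q)
    (hint : ∀ Q ∈ 𝒬, Integrable (fun x : Fin d → ℝ => x ⬝ᵥ x) Q)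
    (K : ℝ) (hK : K = ⨆ Q ∈ 𝒬, ∫ x, x ⬝ᵥ x ∂Q)
    (hKbdd : BddAbove ((fun Q : Measure (Fin d → ℝ) => ∫ x, x ⬝ᵥ x ∂Q) '' 𝒬))
    (δ : ℝ) (hδ : 0 < δ)
    (hnd : ∀ θ : Fin d → ℝ, δ * (θ ⬝ᵥ θ) ≤ ⨆ Q ∈ 𝒬, ∫ x, (θ ⬝ᵥ x) ^ 2 ∂Q)
    (a : Matrix (Fin d) (Fin d) ℝ) (ha : a.IsSymm)
    (na : ℝ) (hna : ∀ x : Fin d → ℝ, |x ⬝ᵥ a.mulVec x| ≤ na * (x ⬝ᵥ x))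
    (b μ : Fin d → ℝ) (α : ℝ) (hα : 0 < α) :
    ∀ θ : Fin d → ℝ,
      (α * δ / 2) * (θ ⬝ᵥ θ)
          - (α * Real.sqrt (b ⬝ᵥ b) * K + Real.sqrt (μ ⬝ᵥ μ)) * Real.sqrt (θ ⬝ᵥ θ)
          - ((1 / 2) * (α * (b ⬝ᵥ b) + na) * K
            + Real.sqrt (b ⬝ᵥ b) * Real.sqrt (μ ⬝ᵥ μ))
        ≤ (1 / 2) * (⨆ Q ∈ 𝒬, ∫ x, (x ⬝ᵥ a.mulVec x + α * ((b - θ) ⬝ᵥ x) ^ 2) ∂Q)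
          + (b - θ) ⬝ᵥ μ := by
  intro θ
  obtain ⟨B, hB⟩ := hKbdd
  have hle : ∀ Q ∈ 𝒬, ∫ x, x ⬝ᵥ x ∂Q ≤ K := fun Q hQ => by
    rw [hK]
    exact Real.le_biSup_of_forall_le (f := fun Q : Measure (Fin d → ℝ) => ∫ x, x ⬝ᵥ x ∂Q)
      (fun R hR => hB ⟨R, hR, rfl⟩) hQ
  have hnn : ∀ Q : Measure (Fin d → ℝ), 0 ≤ ∫ x, x ⬝ᵥ x ∂Q := fun Q =>
    integral_nonneg dotProduct_self_nonneg_real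
  have hna_le : ∀ Q ∈ 𝒬, na * ∫ x, x ⬝ᵥ x ∂Q ≤ na * K := fun Q hQ => by
    rcases le_or_gt 0 na with h | h
    · exact mul_le_mul_of_nonneg_left (hle Q hQ) h
    · have hz : ∀ x : Fin d → ℝ, x ⬝ᵥ x = 0 := fun x => by
        nlinarith [dotProduct_self_nonneg_real x, (abs_nonneg _).trans (hna x)]
      simp [hK, hz]
  have hK0 : 0 ≤ K := by
    obtain ⟨Q, hQ⟩ := hne
    exact (hnn Q).trans (hle Q hQ)
  set F : Measure (Fin d → ℝ) → ℝ :=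
    fun Q => ∫ x, (x ⬝ᵥ a.mulVec x + α * ((b - θ) ⬝ᵥ x) ^ 2) ∂Q with hF
  have hFint : ∀ Q ∈ 𝒬,
      Integrable (fun x => x ⬝ᵥ a.mulVec x + α * ((b - θ) ⬝ᵥ x) ^ 2) Q := fun Q hQ =>
    (integrable_dotProduct_mulVec (hint Q hQ) hna).add
      ((integrable_sq_dotProduct (hint Q hQ) (b - θ)).const_mul α)
  have hF_le : ∀ Q ∈ 𝒬, F Q ≤ na * K + α * ((b - θ) ⬝ᵥ (b - θ)) * K := fun Q hQ => by
    have hmono : F Q ≤ ∫ x, (na + α * ((b - θ) ⬝ᵥ (b - θ))) * (x ⬝ᵥ x) ∂Q := by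
      refine integral_mono (hFint Q hQ) ((hint Q hQ).const_mul _) fun x => ?_
      have h := mul_le_mul_of_nonneg_left (sq_dotProduct_le (b - θ) x) hα.le
      linarith [(le_abs_self _).trans (hna x)]
    rw [integral_const_mul] at hmono
    have h := mul_le_mul_of_nonneg_left (hle Q hQ)
      (mul_nonneg hα.le (dotProduct_self_nonneg_real (b - θ)))
    linarith [hna_le Q hQ]
  have hF_sup : ∀ Q ∈ 𝒬, F Q ≤ ⨆ R ∈ 𝒬, F R := fun Q hQ =>
    Real.le_biSup_of_forall_le hF_le hQ
  set S : ℝ := ⨆ R ∈ 𝒬, F R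
  set sb := √(b ⬝ᵥ b)
  set sθ := √(θ ⬝ᵥ θ)
  have hsb : 0 ≤ sb := Real.sqrt_nonneg _
  have hsθ : 0 ≤ sθ := Real.sqrt_nonneg _
  have hθ_le : ∀ Q ∈ 𝒬,
      ∫ x, (θ ⬝ᵥ x) ^ 2 ∂Q ≤ (S + na * K + 2 * α * (sb * sθ) * K) / α := fun Q hQ => by
    have hmono : ∫ x, α * (θ ⬝ᵥ x) ^ 2 ∂Q ≤
        ∫ x, ((x ⬝ᵥ a.mulVec x + α * ((b - θ) ⬝ᵥ x) ^ 2) +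
          (na + 2 * α * (sb * sθ)) * (x ⬝ᵥ x)) ∂Q := by
      refine integral_mono ((integrable_sq_dotProduct (hint Q hQ) θ).const_mul α)
        ((hFint Q hQ).add ((hint Q hQ).const_mul _)) fun x => ?_
      have h := mul_le_mul_of_nonneg_left (sq_dotProduct_le_sq_dotProduct_sub_add b θ x) hα.le
      linarith [(abs_le.mp (hna x)).1]
    rw [integral_add (hFint Q hQ) ((hint Q hQ).const_mul _), integral_const_mul,
      integral_const_mul] at hmono
    have h := mul_le_mul_of_nonneg_left (hle Q hQ)
      (by positivity : 0 ≤ 2 * α * (sb * sθ))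
    rw [le_div_iff₀ hα]
    linarith [hna_le Q hQ, hF_sup Q hQ]
  have hsup_le : δ * (θ ⬝ᵥ θ) ≤ (S + na * K + 2 * α * (sb * sθ) * K) / α := by
    obtain ⟨Q, hQ⟩ := hne
    have h0 := (integral_nonneg fun x => sq_nonneg (θ ⬝ᵥ x)).trans (hθ_le Q hQ)
    exact (hnd θ).trans (Real.iSup_le (fun R => Real.iSup_le (hθ_le R) h0) h0)
  rw [le_div_iff₀ hα] at hsup_le
  have hbμ := (abs_le.mp (abs_dotProduct_le_sqrt_mul_sqrt b μ)).1
  have hθμ := (abs_le.mp (abs_dotProduct_le_sqrt_mul_sqrt θ μ)).2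
  have hbK : 0 ≤ α * (b ⬝ᵥ b) * K :=
    mul_nonneg (mul_nonneg hα.le (dotProduct_self_nonneg_real b)) hK0
  rw [sub_dotProduct]
  linarith
end
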